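/- Let g and h be homotopy data triples and let k be a prime homotopy data triple. If the product of g and k is isomorphic to the product of h and k, then g and h are isomorphic. -/

import Mathlib

/-- A homotopy data triple: a finite set `α` (here: a finite type), an involution `τ`
on it, and a subset `S ⊆ α × α × α`. -/
structure HDT where
  carrier : Type
  finite : Finite carrier
  tau : carrier → carrier
  tau_inv : ∀ a, tau (tau a) = a
  S : Set (carrier × carrier × carrier)

namespace HDT

/-- Isomorphism of homotopy data triples. -/
def Iso (f g : HDT) : Prop :=
  ∃ e : f.carrier ≃ g.carrier,
    (∀ a, e (f.tau a) = g.tau (e a)) ∧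
    (∀ a b c, (a, b, c) ∈ f.S ↔ (e a, e b, e c) ∈ g.S)

/-- The restriction of a homotopy data triple to a `τ`-invariant subset `β`:
the triple `(β, τ|β, S ∩ β³)`. -/
def restrict (h : HDT) (β : Set h.carrier) (hβ : ∀ a ∈ β, h.tau a ∈ β) : HDT where
  carrier := { a : h.carrier // a ∈ β }
  finite := by haveI := h.finite; exact Subtype.finite
  tau := fun x => ⟨h.tau x.1, hβ x.1 x.2⟩
  tau_inv := fun x => Subtype.ext (h.tau_inv x.1)
  S := { t | (t.1.1, t.2.1.1, t.2.2.1) ∈ h.S }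

/-- `S` splits along `β`: every triple of `S` lies entirely in `β³` or entirely in
`(α − β)³`. -/
def Splits (h : HDT) (β : Set h.carrier) : Prop :=
  ∀ t ∈ h.S, (t.1 ∈ β ∧ t.2.1 ∈ β ∧ t.2.2 ∈ β) ∨ (t.1 ∉ β ∧ t.2.1 ∉ β ∧ t.2.2 ∉ β)

/-- `k` is a factor of `h`: `k` is (isomorphic to) the restriction of `h` to some
`τ`-invariant subset `β` along which `S` splits. -/
def IsFactorOf (k h : HDT) : Prop :=
  ∃ (β : Set h.carrier) (hβ : ∀ a ∈ β, h.tau a ∈ β),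
    h.Splits β ∧ Iso k (h.restrict β hβ)

/-- A homotopy data triple is composite if it has a proper factor. -/
def IsComposite (h : HDT) : Prop :=
  ∃ β : Set h.carrier,
    (∀ a ∈ β, h.tau a ∈ β) ∧ h.Splits β ∧ β.Nonempty ∧ β ≠ Set.univ

/-- A homotopy data triple is prime if its underlying set is nonempty and it has no
proper factor. -/
def IsPrime (h : HDT) : Prop := Nonempty h.carrier ∧ ¬ h.IsComposite

/-- The product of two homotopy data triples (carried by the disjoint union of the
underlying sets). -/
def prod (f g : HDT) : HDT where
  carrier := f.carrier ⊕ g.carrier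
  finite := by haveI := f.finite; haveI := g.finite; exact inferInstance
  tau := Sum.map f.tau g.tau
  tau_inv := by
    intro a
    cases a with
    | inl x => simp [Sum.map, f.tau_inv]
    | inr x => simp [Sum.map, g.tau_inv]
  S := { t |
    (∃ a b c, (a, b, c) ∈ f.S ∧ t = (Sum.inl a, Sum.inl b, Sum.inl c)) ∨
    (∃ a b c, (a, b, c) ∈ g.S ∧ t = (Sum.inr a, Sum.inr b, Sum.inr c)) }

/-- The unit for the product: the empty homotopy data triple. -/
def unit : HDT where
  carrier := Empty
  finite := inferInstance
  tau := id
  tau_inv := fun a => rfl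
  S := ∅

/-- The product of a finite list of homotopy data triples. -/
def listProd : List HDT → HDT
  | [] => unit
  | h :: t => h.prod (listProd t)

end HDT

theorem HDT.prod_S_lll (f g : HDT) (a b c) :
    ((Sum.inl a, Sum.inl b, Sum.inl c) : _ × _ × _) ∈ (f.prod g).S ↔ (a, b, c) ∈ f.S := by
  constructor
  · rintro (⟨a', b', c', h, h'⟩ | ⟨a', b', c', h, h'⟩)
    all_goals
      simp only [Prod.mk.injEq, Sum.inl.injEq, Sum.inr.injEq, reduceCtorEq, false_and] at h'
    obtain ⟨rfl, rfl, rfl⟩ := h'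
    exact h
  · intro h
    left
    exact ⟨a, b, c, h, rfl⟩

theorem HDT.prod_S_rrr (f g : HDT) (a b c) :
    ((Sum.inr a, Sum.inr b, Sum.inr c) : _ × _ × _) ∈ (f.prod g).S ↔ (a, b, c) ∈ g.S := by
  constructor
  · rintro (⟨a', b', c', h, h'⟩ | ⟨a', b', c', h, h'⟩)
    all_goals
      simp only [Prod.mk.injEq, Sum.inl.injEq, Sum.inr.injEq, reduceCtorEq, false_and] at h'
    obtain ⟨rfl, rfl, rfl⟩ := h'
    exact h
  · intro h
    right
    exact ⟨a, b, c, h, rfl⟩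

theorem HDT.prod_S_cases (f g : HDT) (x y z : f.carrier ⊕ g.carrier)
    (h : ((x, y, z) : _ × _ × _) ∈ (f.prod g).S) :
    (∃ a b c, x = Sum.inl a ∧ y = Sum.inl b ∧ z = Sum.inl c) ∨
    (∃ a b c, x = Sum.inr a ∧ y = Sum.inr b ∧ z = Sum.inr c) := by
  rcases h with ⟨a, b, c, _, h⟩ | ⟨a, b, c, _, h⟩
  · left; simp only [Prod.mk.injEq] at h; exact ⟨a, b, c, h⟩
  · right; simp only [Prod.mk.injEq] at h; exact ⟨a, b, c, h⟩

theorem HDT.cancel_aux (g h k : HDT) (hk : k.IsPrime)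
    (e : g.carrier ⊕ k.carrier ≃ h.carrier ⊕ k.carrier)
    (he : ∀ x, e (Sum.map g.tau k.tau x) = Sum.map h.tau k.tau (e x))
    (hS : ∀ x y z : g.carrier ⊕ k.carrier, ((x, y, z) : _ × _ × _) ∈ (g.prod k).S ↔
      ((e x, e y, e z) : _ × _ × _) ∈ (h.prod k).S) : g.Iso h := by
  have := g.finite
  have := h.finite
  have := k.finite
  have dich : (∀ c, ∃ d, e (Sum.inr c) = Sum.inr d) ∨ (∀ c, ∃ d, e (Sum.inr c) = Sum.inl d) := by
    by_contra hcon
    push Not at hcon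
    obtain ⟨⟨c, hc⟩, ⟨c', hc'⟩⟩ := hcon
    refine hk.2 ⟨{c | ∃ d, e (Sum.inr c) = Sum.inr d}, ?_, ?_, ?_, ?_⟩
    · rintro a ⟨d, hd⟩
      refine ⟨k.tau d, ?_⟩
      have := he (Sum.inr a)
      rw [hd] at this
      simpa using this
    · rintro ⟨x, y, z⟩ ht
      have h1 := (hS _ _ _).1 ((HDT.prod_S_rrr g k x y z).2 ht)
      rcases HDT.prod_S_cases _ _ _ _ _ h1 with ⟨a, b, c, h1, h2, h3⟩ | ⟨a, b, c, h1, h2, h3⟩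
      · right; simp [h1, h2, h3]
      · left; simp [h1, h2, h3]
    · rcases h' : e (Sum.inr c') with d | d
      · exact absurd h' (hc' d)
      · exact ⟨c', d, h'⟩
    · intro hu
      have : c ∈ (Set.univ : Set k.carrier) := trivial
      rw [← hu] at this
      obtain ⟨d, hd⟩ := this
      exact hc d hd
  have ex : ∀ a, ∃ b, e (Sum.inl a) = Sum.inl b ∨
      ∃ c, e (Sum.inl a) = Sum.inr c ∧ e (Sum.inr c) = Sum.inl b := by
    intro a
    rcases h1 : e (Sum.inl a) with b | c
    · exact ⟨b, Or.inl rfl⟩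
    · rcases dich with hd | hd
      · exfalso
        choose f hf using hd
        have hinj : Function.Injective f := by
          intro x y hxy
          have : e (Sum.inr x) = e (Sum.inr y) := by rw [hf, hf, hxy]
          simpa using this
        obtain ⟨c', hc'⟩ := Finite.surjective_of_injective hinj c
        have : e (Sum.inl a) = e (Sum.inr c') := by rw [hf, hc', h1]
        simp at this
      · obtain ⟨b, hb⟩ := hd c
        exact ⟨b, Or.inr ⟨c, rfl, hb⟩⟩
  choose f hf using ex
  have hinj : Function.Injective f := by
    intro x y hxy
    have hx := hf x
    have hy := hf y
    rw [← hxy] at hy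
    rcases hx with hx | ⟨c, hx, hx'⟩ <;> rcases hy with hy | ⟨d, hy, hy'⟩
    · simpa using hx.trans hy.symm
    · simpa using hx.trans hy'.symm
    · simpa using hx'.trans hy.symm
    · have : c = d := by simpa using hx'.trans hy'.symm
      subst this
      simpa using hx.trans hy.symm
  have hcard : Nat.card g.carrier = Nat.card h.carrier := by
    have := Nat.card_congr e
    rw [Nat.card_sum, Nat.card_sum] at this
    omega
  have hbij : Function.Bijective f := (Nat.bijective_iff_injective_and_card f).2 ⟨hinj, hcard⟩
  refine ⟨Equiv.ofBijective f hbij, ?_, ?_⟩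
  · intro a
    simp only [Equiv.ofBijective_apply]
    have h1 := he (Sum.inl a)
    have h2 := hf (g.tau a)
    simp only [Sum.map_inl] at h1
    rcases hf a with h3 | ⟨c, h3, h4⟩
    · rw [h3, Sum.map_inl] at h1
      rw [h1] at h2
      simpa [eq_comm] using h2
    · rw [h3, Sum.map_inr] at h1
      rw [h1] at h2
      have h5 := he (Sum.inr c)
      rw [h4, Sum.map_inl, Sum.map_inr] at h5
      simp only [reduceCtorEq, Sum.inr.injEq, false_or] at h2
      obtain ⟨d, rfl, h2⟩ := h2
      simpa using h2.symm.trans h5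
  · intro a b c
    simp only [Equiv.ofBijective_apply]
    have ha := hf a
    have hb := hf b
    have hc := hf c
    rw [← HDT.prod_S_lll g k, ← HDT.prod_S_lll h k, hS]
    have key := HDT.prod_S_cases h k
    have key' := HDT.prod_S_cases g k
    rcases ha with ha | ⟨a', ha, ha'⟩ <;> rcases hb with hb | ⟨b', hb, hb'⟩ <;>
      rcases hc with hc | ⟨c', hc, hc'⟩
    case inl.inl.inl => rw [ha, hb, hc]
    case inr.inr.inr =>
      rw [ha, hb, hc, HDT.prod_S_rrr, ← ha', ← hb', ← hc', ← hS, HDT.prod_S_rrr]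
    all_goals
      constructor
      · intro hh
        have := key _ _ _ hh
        simp [ha, hb, hc] at this
      · intro hh
        first | rw [← ha'] at hh | rw [← ha] at hh
        first | rw [← hb'] at hh | rw [← hb] at hh
        first | rw [← hc'] at hh | rw [← hc] at hh
        have := key' _ _ _ ((hS _ _ _).2 hh)
        simp at this

/-- cancellation of a prime factor: if `g · k ≅ h · k` with `k` prime,
then `g ≅ h`. -/
theorem stmt7 (g h k : HDT) (hk : k.IsPrime) (hiso : (g.prod k).Iso (h.prod k)) :
    g.Iso h := by
  obtain ⟨e, he, hS⟩ := hiso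
  exact HDT.cancel_aux g h k hk e he hS
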